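/- arXiv:1309.7460 — 3 statements merged into one kernel-verified Lean document; each statement's English description precedes it below -/
import Mathlib

section
/- Let X be a finite nonempty set, let U be the uniform distribution on X, and let D = (p_x)_{x∈X} be a probability distribution on X. Let Z ⊆ X satisfy |Z| ≥ (1−α)·|X| with 0 ≤ α < 1, and let M be a real number with (1−β)·|X| ≤ M ≤ |X| where 0 ≤ β < 1. Then (1/2)·∑_{x∈X} |p_x − 1/|X|| ≥ ((1−α)/4)·(|{x ∈ Z : |M·p_x − 1| ≥ 1/2}| / |Z|) − β/(2−2β). -/
/-- Lemma: if `D = (p_x)` is a distribution on a finite nonempty set `X`, `Z ⊆ X` has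
`|Z| ≥ (1−α)|X|`, and `(1−β)|X| ≤ M ≤ |X|`, then the total variation distance between
`D` and the uniform distribution is at least
`((1−α)/4)·Pr_{x∈Z}[|M·p_x − 1| ≥ 1/2] − β/(2−2β)`. -/
theorem variation_distance_from_uniform_lower_bound
    {X : Type*} [Fintype X] [Nonempty X]
    (p : X → ℝ) (hp0 : ∀ x, 0 ≤ p x) (hp1 : ∑ x, p x = 1)
    (α β : ℝ) (hα0 : 0 ≤ α) (hα1 : α < 1) (hβ0 : 0 ≤ β) (hβ1 : β < 1)
    (Z : Finset X) (hZ : (1 - α) * (Fintype.card X : ℝ) ≤ (Z.card : ℝ))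
    (M : ℝ) (hM1 : (1 - β) * (Fintype.card X : ℝ) ≤ M) (hM2 : M ≤ (Fintype.card X : ℝ)) :
    ((1 - α) / 4) * (((Z.filter fun x => 1/2 ≤ |M * p x - 1|).card : ℝ) / (Z.card : ℝ))
        - β / (2 - 2 * β)
      ≤ (1/2) * ∑ x, |p x - 1 / (Fintype.card X : ℝ)| := by
  classical
  set N : ℝ := (Fintype.card X : ℝ) with hN
  have hNpos : 0 < N := by
    rw [hN]; exact_mod_cast Fintype.card_pos
  have hb : 0 < 1 - β := by linarith
  have ha : 0 < 1 - α := by linarith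
  have hMpos : 0 < M := lt_of_lt_of_le (mul_pos hb hNpos) hM1
  have hZpos : 0 < (Z.card : ℝ) := lt_of_lt_of_le (mul_pos ha hNpos) hZ
  set F := Z.filter fun x => 1/2 ≤ |M * p x - 1| with hF
  have hinv : 1 / N ≤ 1 / M := one_div_le_one_div_of_le hMpos hM2
  have key : ∀ x, (if x ∈ F then 1 / (2 * N) else 0) - (1 / M - 1 / N) ≤ |p x - 1 / N| := by
    intro x
    split_ifs with h
    · have h1 : 1/2 ≤ |M * p x - 1| := (Finset.mem_filter.mp h).2
      have h2 : M * p x - 1 = M * (p x - 1 / M) := by field_simp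
      rw [h2, abs_mul, abs_of_pos hMpos] at h1
      have h3 : 1 / M / 2 ≤ |p x - 1 / M| := by
        rw [div_div, div_le_iff₀ (by positivity)]
        linarith
      have h4 : |p x - 1 / M| ≤ |p x - 1 / N| + |1 / N - 1 / M| := abs_sub_le _ _ _
      rw [abs_sub_comm (1 / N), abs_of_nonneg (sub_nonneg.mpr hinv)] at h4
      have h5 : 1 / (2 * N) = 1 / N / 2 := by field_simp
      rw [h5]
      linarith
    · have := abs_nonneg (p x - 1 / N)
      linarith
  have hsum := Finset.sum_le_sum (fun x (_ : x ∈ Finset.univ) => key x)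
  rw [Finset.sum_sub_distrib, Finset.sum_ite_mem, Finset.univ_inter, Finset.sum_const,
    Finset.sum_const, Finset.card_univ, nsmul_eq_mul, nsmul_eq_mul, ← hN] at hsum
  have e1 : N * (1 / M - 1 / N) ≤ β / (1 - β) := by
    have : N * (1 / M - 1 / N) = (N - M) / M := by field_simp
    rw [this, div_le_div_iff₀ hMpos hb]
    nlinarith
  have e2 : β / (2 - 2 * β) = β / (1 - β) / 2 := by
    rw [div_div]; congr 1; ring
  have e3 : (1 - α) / 4 * ((F.card : ℝ) / Z.card) ≤ F.card * (1 / (2 * N)) / 2 := by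
    have h1 : (1 - α) / Z.card ≤ 1 / N := by
      rw [div_le_div_iff₀ hZpos hNpos]; linarith
    have h2 : (1 - α) / 4 * ((F.card : ℝ) / Z.card) = (F.card : ℝ) / 4 * ((1 - α) / Z.card) := by
      ring
    have h3 : (F.card : ℝ) * (1 / (2 * N)) / 2 = (F.card : ℝ) / 4 * (1 / N) := by
      field_simp; norm_num
    rw [h2, h3]
    exact mul_le_mul_of_nonneg_left h1 (by positivity)
  rw [e2]
  linarith
end

section
/- There exists a constant C such that for all n ≥ 1 the following holds. Let L = ln Y₁ + ⋯ + ln Y_n, where Y₁,…,Y_n are iid random variables with the Gamma distribution of shape n and rate 1, and let L′ be a real Gaussian random variable with mean n·E[ln Y₁] and variance n·Var[ln Y₁]. Then for all x ∈ ℝ, |Pr[L ≤ x] − Pr[L′ ≤ x]| ≤ C/√n. -/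
open MeasureTheory ProbabilityTheory Real

/-- The Gamma distribution with (integer) shape `n` and rate 1: density
`y^{n−1}·e^{−y}/(n−1)!` on `(0, ∞)`. -/
noncomputable def gammaDist (n : ℕ) : Measure ℝ :=
  volume.withDensity fun y =>
    if 0 < y then ENNReal.ofReal (y ^ (n - 1) * Real.exp (-y) / (n - 1).factorial) else 0

noncomputable def gp (k : ℕ) (y : ℝ) : ℝ := y ^ k * Real.exp (-y) / k.factorial

lemma gp_meas (k : ℕ) : Measurable (gp k) := by unfold gp; fun_prop

lemma gp_nonneg (k : ℕ) {y : ℝ} (hy : 0 < y) : 0 ≤ gp k y := by unfold gp; positivity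

lemma gd_eq (k : ℕ) : gammaDist (k + 1) =
    (volume.restrict (Set.Ioi 0)).withDensity (fun y => ENNReal.ofReal (gp k y)) := by
  rw [← withDensity_indicator measurableSet_Ioi]
  unfold gammaDist gp
  congr 1

lemma gd_integral (k : ℕ) (f : ℝ → ℝ) :
    ∫ y, f y ∂(gammaDist (k + 1)) = ∫ y in Set.Ioi 0, gp k y * f y := by
  rw [gd_eq, integral_withDensity_eq_integral_toReal_smul
    (gp_meas k).ennreal_ofReal (by simp)]
  refine setIntegral_congr_fun measurableSet_Ioi fun y hy => ?_
  simp only [smul_eq_mul]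
  rw [ENNReal.toReal_ofReal (gp_nonneg k hy)]

lemma gd_integrable_iff (k : ℕ) (f : ℝ → ℝ) :
    Integrable f (gammaDist (k + 1)) ↔ IntegrableOn (fun y => gp k y * f y) (Set.Ioi 0) := by
  rw [gd_eq, integrable_withDensity_iff_integrable_smul'
    (gp_meas k).ennreal_ofReal (by simp)]
  refine integrableOn_congr_fun (fun y hy => ?_) measurableSet_Ioi
  simp only [smul_eq_mul]
  rw [ENNReal.toReal_ofReal (gp_nonneg k hy)]

lemma pow_exp_integrable (j : ℕ) :
    IntegrableOn (fun y : ℝ => y ^ j * Real.exp (-y)) (Set.Ioi 0) := by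
  have h := Real.GammaIntegral_convergent (s := (j : ℝ) + 1) (by positivity)
  refine h.congr_fun (fun y hy => ?_) measurableSet_Ioi
  simp only [add_sub_cancel_right, Real.rpow_natCast]
  ring

lemma pow_exp_integral (j : ℕ) :
    ∫ y in Set.Ioi (0 : ℝ), y ^ j * Real.exp (-y) = j.factorial := by
  rw [← Real.Gamma_nat_eq_factorial, Real.Gamma_eq_integral (by positivity)]
  refine setIntegral_congr_fun measurableSet_Ioi fun y hy => ?_
  simp only [add_sub_cancel_right, Real.rpow_natCast]
  ring

/-- Moments: `y^j / y^2` under Gamma of shape `k+1 ≥ 3`. -/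
lemma gd_mom_integrable (k : ℕ) (j : ℕ) :
    Integrable (fun y : ℝ => y ^ j / y ^ 2) (gammaDist (k + 2 + 1)) := by
  rw [gd_integrable_iff]
  have h : IntegrableOn (fun y : ℝ => y ^ (k + j) * Real.exp (-y) / (k + 2).factorial)
    (Set.Ioi 0) := (pow_exp_integrable (k + j)).div_const _
  refine h.congr_fun (fun y hy => ?_) measurableSet_Ioi
  have hy' : (0 : ℝ) < y := hy
  unfold gp
  field_simp
  ring

lemma gd_mom (k : ℕ) (j : ℕ) :
    ∫ y : ℝ, y ^ j / y ^ 2 ∂(gammaDist (k + 2 + 1)) = (k + j).factorial / (k + 2).factorial := by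
  rw [gd_integral, ← pow_exp_integral (k + j), ← integral_div]
  refine setIntegral_congr_fun measurableSet_Ioi fun y hy => ?_
  have hy' : (0 : ℝ) < y := hy
  unfold gp
  field_simp
  ring

instance gd_prob (k : ℕ) : IsProbabilityMeasure (gammaDist (k + 1)) := by
  constructor
  rw [gd_eq, withDensity_apply _ MeasurableSet.univ, Measure.restrict_univ,
    ← ofReal_integral_eq_lintegral_ofReal]
  · have : ∫ y in Set.Ioi 0, gp k y = 1 := by
      have h := pow_exp_integral k
      unfold gp
      rw [integral_div, h, div_self]
      positivity
    rw [this]; simp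
  · exact (pow_exp_integrable k).div_const _
  · exact (ae_restrict_iff' measurableSet_Ioi).2 (Filter.Eventually.of_forall
      fun y hy => gp_nonneg k hy)

lemma gd_pos (k : ℕ) : ∀ᵐ y ∂(gammaDist (k + 1)), 0 < y := by
  rw [gd_eq]
  refine (withDensity_absolutelyContinuous _ _).ae_le ?_
  exact (ae_restrict_iff' measurableSet_Ioi).2 (Filter.Eventually.of_forall fun y hy => hy)

lemma gd_integrable_of_bound (k : ℕ) (f : ℝ → ℝ) (hf : Measurable f) (C : ℝ)
    (h : ∀ y, 0 < y → |f y| ≤ C * ((1 + y ^ 4) / y ^ 2)) :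
    Integrable f (gammaDist (k + 2 + 1)) := by
  have h1 : Integrable (fun y : ℝ => C * (y ^ 0 / y ^ 2 + y ^ 4 / y ^ 2)) (gammaDist (k + 2 + 1)) :=
    ((gd_mom_integrable k 0).add (gd_mom_integrable k 4)).const_mul C
  refine h1.mono' hf.aestronglyMeasurable ?_
  filter_upwards [gd_pos (k + 2)] with y hy
  refine (h y hy).trans (le_of_eq ?_)
  ring

lemma abs_log_le {y : ℝ} (hy : 0 < y) : |Real.log y| ≤ y + 1 / y := by
  have h1 := Real.log_le_sub_one_of_pos hy
  have h2 := Real.one_sub_inv_le_log_of_pos hy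
  rw [abs_le]
  have : (0:ℝ) < 1 / y := by positivity
  constructor
  · rw [one_div]; linarith
  · linarith

lemma lin_bound {y N : ℝ} (hy : 0 < y) (hN : 0 ≤ N) :
    (1 + |Real.log y|) * (y + N) ≤ (6 * (N + 1)) * ((1 + y ^ 4) / y ^ 2) := by
  have h := abs_log_le hy
  calc (1 + |Real.log y|) * (y + N) ≤ (1 + (y + 1 / y)) * (y + N) := by gcongr
    _ = (y * (y + y ^ 2 + 1) * (y + N)) / y ^ 2 := by field_simp; ring
    _ ≤ (6 * (N + 1)) * ((1 + y ^ 4) / y ^ 2) := by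
      rw [← mul_div_assoc]
      refine div_le_div_of_nonneg_right ?_ (by positivity)
      have a1 : y ≤ 1 + y ^ 4 := by nlinarith [sq_nonneg (y ^ 2 - 1), sq_nonneg (y - 1), sq_nonneg (y^2)]
      have a2 : y ^ 2 ≤ 1 + y ^ 4 := by nlinarith [sq_nonneg (y ^ 2 - 1)]
      have a3 : y ^ 3 ≤ 1 + y ^ 4 := by nlinarith [sq_nonneg (y ^ 2 - y), sq_nonneg (y^2 - 1)]
      nlinarith [mul_le_mul_of_nonneg_left a1 hN, mul_le_mul_of_nonneg_left a2 hN,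
        mul_le_mul_of_nonneg_left a3 hN, pow_pos hy 4]

lemma log_bound {y : ℝ} (hy : 0 < y) :
    1 + |Real.log y| ≤ 12 * ((1 + y ^ 4) / y ^ 2) := by
  have := lin_bound hy (N := 1) (by norm_num)
  have h2 : 0 ≤ 1 + |Real.log y| := by positivity
  nlinarith

lemma log_sq_bound {y : ℝ} (hy : 0 < y) :
    (Real.log y) ^ 2 ≤ 2 * ((1 + y ^ 4) / y ^ 2) := by
  have h := abs_log_le hy
  calc (Real.log y) ^ 2 = |Real.log y| ^ 2 := (sq_abs _).symm
    _ ≤ (y + 1 / y) ^ 2 := by gcongr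
    _ = (y ^ 2 + 1) ^ 2 / y ^ 2 := by field_simp
    _ ≤ 2 * ((1 + y ^ 4) / y ^ 2) := by
      rw [← mul_div_assoc]
      gcongr
      nlinarith [sq_nonneg (y ^ 2 - 1)]

lemma gamma_ibp (k : ℕ) (F F' : ℝ → ℝ) (b : ℝ) (hb : 0 < b) (C : ℝ) (hC : 0 ≤ C)
    (hFm : Measurable F) (hF'm : Measurable F')
    (hc : ∀ y, 0 < y → ContinuousAt F y)
    (hd : ∀ y, 0 < y → y ≠ b → HasDerivAt F (F' y / y) y)
    (hF : ∀ y, 0 < y → |F y| ≤ C * (1 + |Real.log y|))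
    (hF' : ∀ y, 0 < y → |F' y| ≤ C * (1 + |Real.log y|)) :
    Integrable F (gammaDist (k + 2 + 1)) ∧
    Integrable F' (gammaDist (k + 2 + 1)) ∧
    Integrable (fun y => F y * (y - (k + 3))) (gammaDist (k + 2 + 1)) ∧
    ∫ y, F' y ∂(gammaDist (k + 2 + 1)) = ∫ y, F y * (y - (k + 3)) ∂(gammaDist (k + 2 + 1)) := by
  have i0 : Integrable F (gammaDist (k + 2 + 1)) := by
    refine gd_integrable_of_bound k F hFm (C * 12) fun y hy => (hF y hy).trans ?_
    rw [mul_assoc]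
    exact mul_le_mul_of_nonneg_left (log_bound hy) hC
  have i1 : Integrable F' (gammaDist (k + 2 + 1)) := by
    refine gd_integrable_of_bound k F' hF'm (C * 12) fun y hy => (hF' y hy).trans ?_
    rw [mul_assoc]
    exact mul_le_mul_of_nonneg_left (log_bound hy) hC
  have i2 : Integrable (fun y => F y * (y - (k + 3))) (gammaDist (k + 2 + 1)) := by
    refine gd_integrable_of_bound k _ (by fun_prop) (C * (6 * ((k + 3 : ℝ) + 1))) fun y hy => ?_
    rw [abs_mul, mul_assoc]
    have h1 : |y - (k + 3 : ℝ)| ≤ y + (k + 3) := by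
      rw [abs_le]; constructor <;> linarith [(Nat.cast_nonneg k : (0:ℝ) ≤ k)]
    calc |F y| * |y - (k + 3 : ℝ)| ≤ (C * (1 + |Real.log y|)) * (y + (k + 3)) :=
          mul_le_mul (hF y hy) h1 (abs_nonneg _) (by positivity)
      _ = C * ((1 + |Real.log y|) * (y + (k + 3))) := by ring
      _ ≤ _ := mul_le_mul_of_nonneg_left (lin_bound hy (by positivity)) hC
  refine ⟨i0, i1, i2, ?_⟩
  rw [← sub_eq_zero, ← integral_sub i1 i2, gd_integral]
  have i3 := (gd_integrable_iff (k + 2) _).1 (i1.sub i2)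
  set g : ℝ → ℝ := fun y => gp (k + 2) y * (F' y - F y * (y - (k + 3))) with hg
  have i4 : IntegrableOn g (Set.Ioi 0) := i3
  set U : ℝ → ℝ := fun y => y * gp (k + 2) y * F y with hU
  have hgp : ∀ y, HasDerivAt (fun y => y * gp (k + 2) y) (gp (k + 2) y * ((k + 3) - y)) y := by
    intro y
    have h1 : (fun y => y * gp (k + 2) y) =
        fun y : ℝ => y ^ (k + 3) * Real.exp (-y) / (k + 2).factorial := by
      funext y; unfold gp; ring
    rw [h1]
    have := (((hasDerivAt_id y).pow (k + 3)).mul ((hasDerivAt_id y).neg.exp)).div_const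
      ((k + 2).factorial : ℝ)
    refine this.congr_deriv ?_
    unfold gp
    simp
    ring
  have hUd : ∀ y, 0 < y → y ≠ b → HasDerivAt U (g y) y := by
    intro y hy hyb
    refine ((hgp y).mul (hd y hy hyb)).congr_deriv ?_
    simp only [hg]
    field_simp
    ring
  have hUc : ∀ y, 0 < y → ContinuousAt U y := fun y hy => (hgp y).continuousAt.mul (hc y hy)
  have hUb : ∀ y, 0 < y → |U y| ≤ C * ((y ^ (k + 4) + y ^ (k + 3) + y ^ (k + 2)) * Real.exp (-y)) := by
    intro y hy
    have h1 : |F y| ≤ C * (1 + (y + 1 / y)) := (hF y hy).trans (by gcongr; exact abs_log_le hy)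
    have h2 : 0 ≤ y * gp (k + 2) y := mul_nonneg hy.le (gp_nonneg _ hy)
    have h3 : y * gp (k + 2) y ≤ y ^ (k + 3) * Real.exp (-y) := by
      unfold gp
      rw [show y * (y ^ (k + 2) * Real.exp (-y) / (k + 2).factorial)
        = (y ^ (k + 3) * Real.exp (-y)) / (k + 2).factorial by ring]
      apply div_le_self (by positivity)
      exact_mod_cast Nat.one_le_iff_ne_zero.2 (Nat.factorial_ne_zero _)
    calc |U y| = (y * gp (k + 2) y) * |F y| := by
          simp only [hU]; rw [abs_mul, abs_of_nonneg h2]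
      _ ≤ (y ^ (k + 3) * Real.exp (-y)) * (C * (1 + (y + 1 / y))) :=
          mul_le_mul h3 h1 (abs_nonneg _) (by positivity)
      _ = _ := by field_simp; ring
  have hU0 : ContinuousWithinAt U (Set.Icc 0 b) 0 := by
    have e0 : U 0 = 0 := by simp [hU]
    unfold ContinuousWithinAt
    rw [e0]
    have ht : Filter.Tendsto (fun y : ℝ => C * ((y ^ (k + 4) + y ^ (k + 3) + y ^ (k + 2))
        * Real.exp (-y))) (nhdsWithin 0 (Set.Icc 0 b)) (nhds 0) := by
      have : Continuous (fun y : ℝ => C * ((y ^ (k + 4) + y ^ (k + 3) + y ^ (k + 2))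
        * Real.exp (-y))) := by fun_prop
      have := (this.tendsto 0).mono_left (nhdsWithin_le_nhds (s := Set.Icc 0 b))
      simpa using this
    refine squeeze_zero_norm' ?_ ht
    filter_upwards [self_mem_nhdsWithin] with y hy
    rcases eq_or_lt_of_le hy.1 with h | h
    · rw [← h, e0]; simp
    · exact hUb y h
  have hUtop : Filter.Tendsto U Filter.atTop (nhds 0) := by
    have ht : Filter.Tendsto (fun y : ℝ => C * ((y ^ (k + 4) + y ^ (k + 3) + y ^ (k + 2))
        * Real.exp (-y))) Filter.atTop (nhds 0) := by
      have h1 := (((Real.tendsto_pow_mul_exp_neg_atTop_nhds_zero (k + 4)).add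
        (Real.tendsto_pow_mul_exp_neg_atTop_nhds_zero (k + 3))).add
        (Real.tendsto_pow_mul_exp_neg_atTop_nhds_zero (k + 2))).const_mul C
      simp only [add_zero, mul_zero] at h1
      refine h1.congr fun y => ?_
      ring
    refine squeeze_zero_norm' ?_ ht
    filter_upwards [Filter.eventually_gt_atTop 0] with y hy
    exact hUb y hy
  have j1 : ∫ y in (0:ℝ)..b, g y = U b - U 0 := by
    refine intervalIntegral.integral_eq_sub_of_hasDeriv_right_of_le hb.le ?_ ?_ ?_
    · intro y hy
      rcases eq_or_lt_of_le hy.1 with h | h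
      · rw [← h]; exact hU0
      · exact (hUc y h).continuousWithinAt
    · intro y hy
      exact (hUd y hy.1 hy.2.ne).hasDerivWithinAt
    · rw [intervalIntegrable_iff_integrableOn_Ioc_of_le hb.le]
      exact i4.mono_set Set.Ioc_subset_Ioi_self
  have j2 : ∫ y in Set.Ioi b, g y = 0 - U b := by
    refine integral_Ioi_of_hasDerivAt_of_tendsto (hUc b hb).continuousWithinAt ?_ ?_ hUtop
    · intro y hy
      exact hUd y (hb.trans hy) (ne_of_gt hy)
    · exact i4.mono_set (Set.Ioi_subset_Ioi hb.le)
  have j3 : ∫ y in Set.Ioi 0, g y = 0 := by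
    rw [← Set.Ioc_union_Ioi_eq_Ioi hb.le, setIntegral_union (Set.Ioc_disjoint_Ioi le_rfl)
      measurableSet_Ioi (i4.mono_set Set.Ioc_subset_Ioi_self)
      (i4.mono_set (Set.Ioi_subset_Ioi hb.le)), j2, ← intervalIntegral.integral_of_le hb.le, j1]
    simp [hU]
  exact j3

noncomputable def gG (x : ℝ) : ℝ := (gaussianReal 0 1).real (Set.Iic x)

lemma gG_nonneg (x : ℝ) : 0 ≤ gG x := measureReal_nonneg
lemma gG_le_one (x : ℝ) : gG x ≤ 1 := measureReal_le_one
lemma gG_mono : Monotone gG := fun _ _ h => measureReal_mono (Set.Iic_subset_Iic.2 h)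

lemma gG_lower (w : ℝ) (hw : w ≤ 0) : gG w ≤ Real.exp (-(w ^ 2 / 2)) := by
  have h := measure_le_le_exp_mul_mgf (X := id) (μ := gaussianReal 0 1) (t := w) w hw
    (by simpa using integrable_exp_mul_gaussianReal (μ := 0) (v := 1) w)
  rw [mgf_id_gaussianReal, ← Real.exp_add] at h
  refine h.trans (le_of_eq ?_)
  congr 1
  simp
  ring

lemma gG_upper (w : ℝ) (hw : 0 ≤ w) : 1 - gG w ≤ Real.exp (-(w ^ 2 / 2)) := by
  have h := measure_ge_le_exp_mul_mgf (X := id) (μ := gaussianReal 0 1) (t := w) w hw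
    (by simpa using integrable_exp_mul_gaussianReal (μ := 0) (v := 1) w)
  rw [mgf_id_gaussianReal, ← Real.exp_add] at h
  have h1 : 1 - gG w = (gaussianReal 0 1).real (Set.Iic w)ᶜ := by
    rw [probReal_compl_eq_one_sub measurableSet_Iic]; rfl
  rw [h1]
  refine (measureReal_mono ?_).trans (h.trans (le_of_eq ?_))
  · intro y hy
    simp at hy ⊢
    exact hy.le
  · congr 1
    simp
    ring

lemma gG_eq (x : ℝ) : gG x = ∫ t in Set.Iic x, gaussianPDFReal 0 1 t := by
  unfold gG
  rw [measureReal_def, gaussianReal_apply_eq_integral _ one_ne_zero, ENNReal.toReal_ofReal]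
  exact integral_nonneg fun _ => gaussianPDFReal_nonneg _ _ _

lemma gG_hasDerivAt (x : ℝ) : HasDerivAt gG (gaussianPDFReal 0 1 x) x := by
  have hc : Continuous (gaussianPDFReal 0 1) := by
    unfold gaussianPDFReal; fun_prop
  have hi := integrable_gaussianPDFReal 0 1
  have h1 : gG = fun x => (∫ t in (0:ℝ)..x, gaussianPDFReal 0 1 t) + gG 0 := by
    funext x
    rw [gG_eq, gG_eq, ← intervalIntegral.integral_Iic_sub_Iic hi.integrableOn hi.integrableOn]
    ring
  rw [h1]
  exact (intervalIntegral.integral_hasDerivAt_right (hi.intervalIntegrable)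
    hc.aestronglyMeasurable.stronglyMeasurableAtFilter hc.continuousAt).add_const _

lemma gG_cont : Continuous gG :=
  continuous_iff_continuousAt.2 fun x => (gG_hasDerivAt x).continuousAt

noncomputable def stF (a w : ℝ) : ℝ :=
  (Real.sqrt (2 * π) * Real.exp (w ^ 2 / 2)) * (min (gG w) (gG a) - gG w * gG a)

noncomputable def stF' (a w : ℝ) : ℝ := w * stF a w + (if w ≤ a then 1 else 0) - gG a

lemma stF_cont (a : ℝ) : Continuous (stF a) := by
  have := gG_cont
  unfold stF; fun_prop

lemma stF'_meas (a : ℝ) : Measurable (stF' a) := by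
  have := (stF_cont a).measurable
  unfold stF'
  refine Measurable.sub (Measurable.add (by fun_prop) ?_) measurable_const
  exact Measurable.ite measurableSet_Iic measurable_const measurable_const

lemma stF_abs_le (a w : ℝ) : |stF a w| ≤ 3 := by
  have a0 := gG_nonneg a
  have a1 := gG_le_one a
  have w0 := gG_nonneg w
  have w1 := gG_le_one w
  have h0 : 0 ≤ min (gG w) (gG a) - gG w * gG a := by
    rcases min_choice (gG w) (gG a) with h | h <;> rw [h] <;> nlinarith
  have hA : min (gG w) (gG a) - gG w * gG a ≤ gG w := by
    have := min_le_left (gG w) (gG a)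
    nlinarith
  have hB : min (gG w) (gG a) - gG w * gG a ≤ 1 - gG w := by
    have := min_le_right (gG w) (gG a)
    nlinarith
  have hC : min (gG w) (gG a) - gG w * gG a ≤ Real.exp (-(w ^ 2 / 2)) := by
    rcases le_total w 0 with h | h
    · exact hA.trans (gG_lower w h)
    · exact hB.trans (gG_upper w h)
  have hs : Real.sqrt (2 * π) ≤ 3 := by
    rw [Real.sqrt_le_left (by norm_num)]
    nlinarith [Real.pi_lt_four]
  unfold stF
  rw [abs_of_nonneg (by positivity)]
  calc (Real.sqrt (2 * π) * Real.exp (w ^ 2 / 2)) * (min (gG w) (gG a) - gG w * gG a)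
      ≤ (3 * Real.exp (w ^ 2 / 2)) * Real.exp (-(w ^ 2 / 2)) := by gcongr
    _ = 3 := by rw [mul_assoc, ← Real.exp_add]; simp

lemma stF'_abs_le (a w : ℝ) : |stF' a w| ≤ 3 * |w| + 1 := by
  have a0 := gG_nonneg a
  have a1 := gG_le_one a
  have h1 : |w * stF a w| ≤ 3 * |w| := by
    rw [abs_mul, mul_comm]
    exact mul_le_mul_of_nonneg_right (stF_abs_le a w) (abs_nonneg _)
  unfold stF'
  rw [add_sub_assoc]
  refine (abs_add_le _ _).trans (add_le_add h1 ?_)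
  split_ifs <;> rw [abs_le] <;> constructor <;> linarith

lemma stF_hasDerivAt (a w : ℝ) (h : w ≠ a) : HasDerivAt (stF a) (stF' a w) w := by
  have hE : HasDerivAt (fun w : ℝ => Real.sqrt (2 * π) * Real.exp (w ^ 2 / 2))
      (w * (Real.sqrt (2 * π) * Real.exp (w ^ 2 / 2))) w := by
    have := ((((hasDerivAt_id w).pow 2).div_const 2).exp).const_mul (Real.sqrt (2 * π))
    refine this.congr_deriv ?_
    simp
    ring
  have hp : (Real.sqrt (2 * π) * Real.exp (w ^ 2 / 2)) * gaussianPDFReal 0 1 w = 1 := by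
    unfold gaussianPDFReal
    have : Real.sqrt (2 * π) ≠ 0 := by positivity
    simp only [NNReal.coe_one, mul_one, sub_zero]
    rw [show (Real.sqrt (2 * π) * Real.exp (w ^ 2 / 2)) * ((Real.sqrt (2 * π))⁻¹ *
      Real.exp (-w ^ 2 / 2)) = (Real.sqrt (2 * π) * (Real.sqrt (2 * π))⁻¹) *
      (Real.exp (w ^ 2 / 2) * Real.exp (-w ^ 2 / 2)) by ring, mul_inv_cancel₀ this,
      ← Real.exp_add]
    ring_nf
    simp
  rcases lt_or_gt_of_ne h with h | h
  · have hd := hE.mul ((gG_hasDerivAt w).sub ((gG_hasDerivAt w).mul_const (gG a)))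
    have he : stF a =ᶠ[nhds w] ((fun w : ℝ => Real.sqrt (2 * π) * Real.exp (w ^ 2 / 2)) *
        (gG - fun y => gG y * gG a)) := by
      filter_upwards [Iio_mem_nhds h] with y hy
      simp only [stF, Pi.mul_apply, Pi.sub_apply]
      rw [min_eq_left (gG_mono (le_of_lt hy))]
    refine (hd.congr_of_eventuallyEq he).congr_deriv ?_
    simp only [stF', stF, Pi.sub_apply]
    rw [min_eq_left (gG_mono h.le), if_pos h.le]
    linear_combination (1 - gG a) * hp
  · have hd := hE.mul (((gG_hasDerivAt w).mul_const (gG a)).const_sub (gG a))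
    have he : stF a =ᶠ[nhds w] ((fun w : ℝ => Real.sqrt (2 * π) * Real.exp (w ^ 2 / 2)) *
        (fun y => gG a - gG y * gG a)) := by
      filter_upwards [Ioi_mem_nhds h] with y hy
      simp only [stF, Pi.mul_apply]
      rw [min_eq_right (gG_mono (le_of_lt hy))]
    refine (hd.congr_of_eventuallyEq he).congr_deriv ?_
    simp only [stF', stF]
    rw [min_eq_right (gG_mono h.le), if_neg (not_le.2 h)]
    linear_combination (- gG a) * hp

lemma gauss_std (m σ x : ℝ) (hσ : 0 < σ) :
    (gaussianReal m (Real.toNNReal (σ ^ 2))).real (Set.Iic x) = gG ((x - m) / σ) := by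
  have h1 : (gaussianReal 0 1).map (fun z => σ * z + m) = gaussianReal m (Real.toNNReal (σ ^ 2)) := by
    have : (fun z : ℝ => σ * z + m) = (fun z => z + m) ∘ (fun z => σ * z) := rfl
    rw [this, ← Measure.map_map (by fun_prop) (by fun_prop), gaussianReal_map_const_mul,
      gaussianReal_map_add_const]
    congr 1
    · ring
    · ext; simp [sq_nonneg]
  rw [← h1, map_measureReal_apply (by fun_prop) measurableSet_Iic]
  unfold gG
  congr 1
  ext z
  simp only [Set.mem_preimage, Set.mem_Iic]
  rw [le_div_iff₀ hσ]
  constructor <;> intro h <;> linarith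

lemma int_add2 {μ : Measure ℝ} {f g : ℝ → ℝ} {a b : ℝ}
    (hf : Integrable f μ ∧ ∫ y, f y ∂μ = a) (hg : Integrable g μ ∧ ∫ y, g y ∂μ = b) :
    Integrable (fun y => f y + g y) μ ∧ ∫ y, (f y + g y) ∂μ = a + b :=
  ⟨hf.1.add hg.1, by rw [integral_add hf.1 hg.1, hf.2, hg.2]⟩

lemma int_cmul {μ : Measure ℝ} {f : ℝ → ℝ} {a : ℝ} (c : ℝ)
    (hf : Integrable f μ ∧ ∫ y, f y ∂μ = a) :
    Integrable (fun y => c * f y) μ ∧ ∫ y, c * f y ∂μ = c * a :=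
  ⟨hf.1.const_mul c, by rw [integral_const_mul, hf.2]⟩

lemma int_cst {μ : Measure ℝ} [IsProbabilityMeasure μ] (c : ℝ) :
    Integrable (fun _ : ℝ => c) μ ∧ ∫ _ : ℝ, c ∂μ = c :=
  ⟨integrable_const c, by simp⟩

lemma gd_int_id (k : ℕ) : Integrable (fun y : ℝ => y) (gammaDist (k + 2 + 1)) ∧
    ∫ y : ℝ, y ∂(gammaDist (k + 2 + 1)) = k + 3 := by
  have h : (fun y : ℝ => y ^ 3 / y ^ 2) = fun y => y := by
    funext y
    rcases eq_or_ne y 0 with h | h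
    · simp [h]
    · field_simp
  have h1 := gd_mom_integrable k 3
  have h2 := gd_mom k 3
  rw [h] at h1
  refine ⟨h1, ?_⟩
  rw [show (fun y : ℝ => y ^ 3 / y ^ 2) = fun y => y from h] at h2
  rw [h2, Nat.factorial_succ (k + 2)]
  push_cast
  field_simp
  ring

lemma gd_int_sq (k : ℕ) : Integrable (fun y : ℝ => y ^ 2) (gammaDist (k + 2 + 1)) ∧
    ∫ y : ℝ, y ^ 2 ∂(gammaDist (k + 2 + 1)) = (k + 3) * (k + 4) := by
  have h : (fun y : ℝ => y ^ 4 / y ^ 2) = fun y => y ^ 2 := by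
    funext y
    rcases eq_or_ne y 0 with h | h
    · simp [h]
    · field_simp
  have h1 := gd_mom_integrable k 4
  have h2 := gd_mom k 4
  rw [h] at h1
  refine ⟨h1, ?_⟩
  rw [h] at h2
  rw [h2, Nat.factorial_succ (k + 3), Nat.factorial_succ (k + 2)]
  push_cast
  field_simp
  ring

lemma gd_int_inv (k : ℕ) : Integrable (fun y : ℝ => 1 / y) (gammaDist (k + 2 + 1)) ∧
    ∫ y : ℝ, 1 / y ∂(gammaDist (k + 2 + 1)) = 1 / (k + 2) := by
  have h : (fun y : ℝ => y ^ 1 / y ^ 2) = fun y => 1 / y := by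
    funext y
    rcases eq_or_ne y 0 with h | h
    · simp [h]
    · field_simp
  have h1 := gd_mom_integrable k 1
  have h2 := gd_mom k 1
  rw [h] at h1
  refine ⟨h1, ?_⟩
  rw [h] at h2
  rw [h2, Nat.factorial_succ (k + 1)]
  push_cast
  field_simp
  ring

lemma gd_int_inv2 (k : ℕ) : Integrable (fun y : ℝ => 1 / y ^ 2) (gammaDist (k + 2 + 1)) ∧
    ∫ y : ℝ, 1 / y ^ 2 ∂(gammaDist (k + 2 + 1)) = 1 / (((k:ℝ) + 1) * ((k:ℝ) + 2)) := by
  have h1 := gd_mom_integrable k 0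
  have h2 := gd_mom k 0
  simp only [pow_zero] at h1 h2
  refine ⟨h1, ?_⟩
  rw [h2, Nat.factorial_succ (k + 1), Nat.factorial_succ k]
  push_cast
  field_simp
  ring_nf

lemma gd_log_ibp (k : ℕ) :
    Integrable Real.log (gammaDist (k + 2 + 1)) ∧
    Integrable (fun y => Real.log y * (y - (k + 3))) (gammaDist (k + 2 + 1)) ∧
    ∫ y, Real.log y * (y - (k + 3)) ∂(gammaDist (k + 2 + 1)) = 1 := by
  obtain ⟨a, b, c, d⟩ := gamma_ibp k Real.log (fun _ => 1) 1 one_pos 1 zero_le_one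
    Real.measurable_log measurable_const (fun y hy => Real.continuousAt_log hy.ne')
    (fun y hy _ => by simpa using Real.hasDerivAt_log hy.ne')
    (fun y hy => by linarith [abs_nonneg (Real.log y)])
    (fun y hy => by simp)
  refine ⟨a, c, ?_⟩
  rw [← d]; simp

lemma gd_log_sq (k : ℕ) : Integrable (fun y => Real.log y ^ 2) (gammaDist (k + 2 + 1)) :=
  gd_integrable_of_bound k _ (by fun_prop) 2 fun y hy => by
    rw [abs_of_nonneg (sq_nonneg _)]; exact log_sq_bound hy

lemma gd_log_sub_sq (k : ℕ) (t : ℝ) :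
    Integrable (fun y => (Real.log y - t) ^ 2) (gammaDist (k + 2 + 1)) := by
  have h : (fun y => (Real.log y - t) ^ 2) =
    fun y => Real.log y ^ 2 - (2 * t) * Real.log y + t ^ 2 := by funext y; ring
  rw [h]
  exact ((gd_log_sq k).sub ((gd_log_ibp k).1.const_mul _)).add (integrable_const _)

lemma gd_sub (k : ℕ) : Integrable (fun y : ℝ => y - (k + 3)) (gammaDist (k + 2 + 1)) ∧
    ∫ y : ℝ, (y - (k + 3)) ∂(gammaDist (k + 2 + 1)) = 0 := by
  obtain ⟨h1, h2⟩ := gd_int_id k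
  refine ⟨h1.sub (integrable_const _), ?_⟩
  rw [integral_sub h1 (integrable_const _), h2]
  simp

lemma gd_sub_sq (k : ℕ) : Integrable (fun y : ℝ => (y - (k + 3)) ^ 2) (gammaDist (k + 2 + 1)) ∧
    ∫ y : ℝ, (y - (k + 3)) ^ 2 ∂(gammaDist (k + 2 + 1)) = (k:ℝ) + 3 := by
  have h : (fun y : ℝ => (y - (k + 3)) ^ 2) =
    fun y : ℝ => (y ^ 2 + (-2 * ((k:ℝ) + 3)) * y) + ((k:ℝ) + 3) ^ 2 := by funext y; ring
  have H := int_add2 (int_add2 (gd_int_sq k) (int_cmul (-2 * ((k:ℝ) + 3)) (gd_int_id k)))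
    (int_cst (((k:ℝ) + 3) ^ 2))
  rw [h]
  exact ⟨H.1, H.2.trans (by ring)⟩

lemma gd_quad (k : ℕ) (c t : ℝ) :
    Integrable (fun y => (c * (y - (k + 3)) - (Real.log y - t)) ^ 2) (gammaDist (k + 2 + 1)) ∧
    ∫ y, (c * (y - (k + 3)) - (Real.log y - t)) ^ 2 ∂(gammaDist (k + 2 + 1))
      = c ^ 2 * (k + 3) - 2 * c + ∫ y, (Real.log y - t) ^ 2 ∂(gammaDist (k + 2 + 1)) := by
  have h : (fun y => (c * (y - (k + 3)) - (Real.log y - t)) ^ 2) =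
      fun y => ((c ^ 2 * (y - (k + 3)) ^ 2 + (-2 * c) * (Real.log y * (y - (k + 3))))
        + (2 * c * t) * (y - (k + 3))) + (Real.log y - t) ^ 2 := by
    funext y; ring
  have H := int_add2 (int_add2 (int_add2 (int_cmul (c ^ 2) (gd_sub_sq k))
    (int_cmul (-2 * c) (gd_log_ibp k).2)) (int_cmul (2 * c * t) (gd_sub k)))
    ⟨gd_log_sub_sq k t, rfl⟩
  rw [h]
  exact ⟨H.1, H.2.trans (by ring)⟩

lemma gd_log_shift (k : ℕ) (t : ℝ) :
    ∫ y, (Real.log y - ∫ w, Real.log w ∂(gammaDist (k + 2 + 1))) ^ 2 ∂(gammaDist (k + 2 + 1))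
      ≤ ∫ y, (Real.log y - t) ^ 2 ∂(gammaDist (k + 2 + 1)) := by
  set μ := ∫ w, Real.log w ∂(gammaDist (k + 2 + 1)) with hμ
  have h : (fun y => (Real.log y - t) ^ 2) = fun y =>
      ((Real.log y - μ) ^ 2 + (2 * (μ - t)) * Real.log y) + ((μ - t) ^ 2 - 2 * (μ - t) * μ) := by
    funext y; ring
  have H := int_add2 (int_add2 ⟨gd_log_sub_sq k μ, rfl⟩
    (int_cmul (2 * (μ - t)) ⟨(gd_log_ibp k).1, hμ.symm⟩))
    (int_cst ((μ - t) ^ 2 - 2 * (μ - t) * μ))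
  rw [h, H.2]
  nlinarith [sq_nonneg (μ - t)]

lemma gd_var_bounds (k : ℕ) (V : ℝ) (hV : V = ∫ y, (Real.log y -
      ∫ w, Real.log w ∂(gammaDist (k + 2 + 1))) ^ 2 ∂(gammaDist (k + 2 + 1))) :
    1 ≤ (k + 3) * V ∧ (k + 3) * V ≤ 1 + 17 / (k + 3) := by
  have hk : (0:ℝ) < k + 3 := by positivity
  constructor
  · have h := (gd_quad k (1 / (k + 3)) (∫ w, Real.log w ∂(gammaDist (k + 2 + 1)))).2
    rw [← hV] at h
    have h0 : 0 ≤ ∫ y, (1 / ((k:ℝ) + 3) * (y - (k + 3)) - (Real.log y -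
      ∫ w, Real.log w ∂(gammaDist (k + 2 + 1)))) ^ 2 ∂(gammaDist (k + 2 + 1)) :=
      integral_nonneg fun _ => sq_nonneg _
    rw [h] at h0
    have e : (1 / ((k:ℝ) + 3)) ^ 2 * (k + 3) - 2 * (1 / ((k:ℝ) + 3)) + V = V - 1 / (k + 3) := by
      field_simp
      ring
    rw [e] at h0
    have : 1 / ((k:ℝ) + 3) ≤ V := by linarith
    rw [div_le_iff₀ hk] at this
    linarith
  · have hq := gd_quad k (1 / (k + 3)) (Real.log (k + 3))
    have hs := gd_log_shift k (Real.log (k + 3))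
    rw [← hV] at hs
    have H := int_add2 (int_add2 (int_add2 (int_add2
      (int_cmul (1 / ((k:ℝ) + 3) ^ 2) (gd_int_sq k)) (int_cmul (-4 / ((k:ℝ) + 3)) (gd_int_id k)))
      (int_cmul (-4 * ((k:ℝ) + 3)) (gd_int_inv k)))
      (int_cmul (((k:ℝ) + 3) ^ 2) (gd_int_inv2 k))) (int_cst (6:ℝ))
    have hle : ∫ y, (1 / ((k:ℝ) + 3) * (y - (k + 3)) - (Real.log y - Real.log (k + 3))) ^ 2
        ∂(gammaDist (k + 2 + 1)) ≤ ∫ y, (((((1 / ((k:ℝ) + 3) ^ 2) * y ^ 2 + (-4 / ((k:ℝ) + 3)) * y)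
          + (-4 * ((k:ℝ) + 3)) * (1 / y)) + (((k:ℝ) + 3) ^ 2) * (1 / y ^ 2)) + 6)
          ∂(gammaDist (k + 2 + 1)) := by
      refine integral_mono_ae hq.1 H.1 ?_
      filter_upwards [gd_pos (k + 2)] with y hy
      have hu : 0 < y / (k + 3) := by positivity
      have e1 : Real.log y - Real.log (k + 3) = Real.log (y / (k + 3)) :=
        (Real.log_div hy.ne' hk.ne').symm
      have e2 : 1 / ((k:ℝ) + 3) * (y - (k + 3)) = y / (k + 3) - 1 := by field_simp
      rw [e1, e2]
      have h1 := Real.log_le_sub_one_of_pos hu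
      have h2 := Real.one_sub_inv_le_log_of_pos hu
      calc (y / (k + 3) - 1 - Real.log (y / (k + 3))) ^ 2
          ≤ (y / (k + 3) - 1 - (1 - (y / (k + 3))⁻¹)) ^ 2 := by
            apply pow_le_pow_left₀ <;> linarith
        _ = _ := by
            field_simp
            ring
    rw [hq.2, H.2] at hle
    have e : (1 / ((k:ℝ) + 3)) ^ 2 * (k + 3) - 2 * (1 / ((k:ℝ) + 3)) = - (1 / (k + 3)) := by
      field_simp
      ring
    rw [e] at hle
    have hk0 : (0:ℝ) ≤ k := Nat.cast_nonneg k
    have e3 : 1 / ((k:ℝ) + 3) ^ 2 * ((k + 3) * (k + 4)) + -4 / (k + 3) * (k + 3) +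
        -4 * (k + 3) * (1 / (k + 2)) + (k + 3) ^ 2 * (1 / ((k + 1) * (k + 2))) + 6
        = (3 * ((k:ℝ)+1)^2 + 14 * (k+1) + 16) / ((k+3)^2 * ((k+2) * (k+1))) := by
      field_simp
      ring
    have e4 : (3 * ((k:ℝ)+1)^2 + 14 * (k+1) + 16) / ((k+3)^2 * ((k+2) * (k+1)))
        ≤ 17 / (k + 3) ^ 2 := by
      rw [div_le_div_iff₀ (by positivity) (by positivity)]
      have : (3 * ((k:ℝ)+1)^2 + 14 * (k+1) + 16) ≤ 17 * ((k+2) * (k+1)) := by nlinarith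
      nlinarith [mul_le_mul_of_nonneg_right this (sq_nonneg ((k:ℝ)+3))]
    have hfin : V ≤ 1 / (k + 3) + 17 / (k + 3) ^ 2 := by
      rw [e3] at hle
      linarith
    calc ((k:ℝ) + 3) * V ≤ (k + 3) * (1 / (k + 3) + 17 / (k + 3) ^ 2) := by gcongr
      _ = 1 + 17 / (k + 3) := by field_simp

lemma prod_ibp (k : ℕ) (a m σ : ℝ) (hσ : 0 < σ) (i : Fin (k + 2 + 1)) :
    Integrable (fun y : Fin (k + 2 + 1) → ℝ => stF' a ((∑ j, Real.log (y j) - m) / σ))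
      (Measure.pi fun _ : Fin (k + 2 + 1) => gammaDist (k + 2 + 1)) ∧
    Integrable (fun y : Fin (k + 2 + 1) → ℝ =>
      stF a ((∑ j, Real.log (y j) - m) / σ) * (y i - (k + 3)))
      (Measure.pi fun _ : Fin (k + 2 + 1) => gammaDist (k + 2 + 1)) ∧
    ∫ y : Fin (k + 2 + 1) → ℝ, stF' a ((∑ j, Real.log (y j) - m) / σ)
      ∂(Measure.pi fun _ : Fin (k + 2 + 1) => gammaDist (k + 2 + 1)) =
    σ * ∫ y : Fin (k + 2 + 1) → ℝ, stF a ((∑ j, Real.log (y j) - m) / σ) * (y i - (k + 3))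
      ∂(Measure.pi fun _ : Fin (k + 2 + 1) => gammaDist (k + 2 + 1)) := by
  set P := (Measure.pi fun _ : Fin (k + 2 + 1) => gammaDist (k + 2 + 1)) with hP
  have hfm := (stF_cont a).measurable
  have hfm' := stF'_meas a
  have hL : Measurable (fun y : Fin (k + 2 + 1) → ℝ => ∑ j, Real.log (y j)) := by fun_prop
  have iL : Integrable (fun y : Fin (k + 2 + 1) → ℝ => ∑ j, Real.log (y j)) P :=
    integrable_finsetSum _ fun j _ =>
      integrable_comp_eval (μ := fun _ : Fin (k + 2 + 1) => gammaDist (k + 2 + 1)) (gd_log_ibp k).1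
  have hW : Integrable (fun y : Fin (k + 2 + 1) → ℝ => (∑ j, Real.log (y j) - m) / σ) P :=
    (iL.sub (integrable_const m)).div_const σ
  have i1 : Integrable (fun y : Fin (k + 2 + 1) → ℝ => stF' a ((∑ j, Real.log (y j) - m) / σ)) P := by
    refine ((hW.abs.const_mul 3).add (integrable_const 1)).mono' ?_ ?_
    · exact (hfm'.comp ((hL.sub_const m).div_const σ)).aestronglyMeasurable
    · exact Filter.Eventually.of_forall fun y => stF'_abs_le a _
  have i2 : Integrable (fun y : Fin (k + 2 + 1) → ℝ =>
      stF a ((∑ j, Real.log (y j) - m) / σ) * (y i - (k + 3))) P := by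
    have hy : Integrable (fun y : Fin (k + 2 + 1) → ℝ => y i - ((k:ℝ) + 3)) P :=
      integrable_comp_eval (μ := fun _ : Fin (k + 2 + 1) => gammaDist (k + 2 + 1)) (i := i)
        (f := fun y : ℝ => y - ((k:ℝ) + 3)) (gd_sub k).1
    refine hy.bdd_mul (c := 3) ?_ ?_
    · exact (hfm.comp ((hL.sub_const m).div_const σ)).aestronglyMeasurable
    · exact Filter.Eventually.of_forall fun y => stF_abs_le a _
  refine ⟨i1, i2, ?_⟩
  have hmp := measurePreserving_piFinSuccAbove (fun _ : Fin (k + 2 + 1) => gammaDist (k + 2 + 1)) i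
  rw [← hP] at hmp
  have hmp' := hmp.symm
  set e := MeasurableEquiv.piFinSuccAbove (fun _ : Fin (k + 2 + 1) => ℝ) i with he
  have hes : ∀ (x : ℝ) (z : Fin (k + 2) → ℝ), e.symm (x, z) = i.insertNth x z := fun _ _ => rfl
  have he1 : ∀ (x : ℝ) (z : Fin (k + 2) → ℝ), ∑ j, Real.log (e.symm (x, z) j)
      = Real.log x + ∑ j, Real.log (z j) := by
    intro x z
    rw [Fin.sum_univ_succAbove _ i]
    simp [hes]
  have he2 : ∀ (x : ℝ) (z : Fin (k + 2) → ℝ), e.symm (x, z) i = x := by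
    intro x z
    simp [hes]
  rw [← hmp'.integral_comp e.symm.measurableEmbedding,
    ← hmp'.integral_comp e.symm.measurableEmbedding, ← integral_const_mul]
  have i1' : Integrable (fun p : ℝ × (Fin (k + 2) → ℝ) =>
      stF' a ((∑ j, Real.log (e.symm p j) - m) / σ))
      ((gammaDist (k + 2 + 1)).prod (Measure.pi fun _ : Fin (k + 2) => gammaDist (k + 2 + 1))) :=
    (hmp'.integrable_comp_emb e.symm.measurableEmbedding).2 i1
  have i2' : Integrable (fun p : ℝ × (Fin (k + 2) → ℝ) =>
      σ * (stF a ((∑ j, Real.log (e.symm p j) - m) / σ) * (e.symm p i - (k + 3))))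
      ((gammaDist (k + 2 + 1)).prod (Measure.pi fun _ : Fin (k + 2) => gammaDist (k + 2 + 1))) :=
    ((hmp'.integrable_comp_emb e.symm.measurableEmbedding).2 i2).const_mul σ
  rw [integral_prod_symm _ i1', integral_prod_symm _ i2']
  congr 1
  funext z
  simp only [he1, he2]
  set s := ∑ j, Real.log (z j) with hs
  obtain ⟨-, -, -, h⟩ := gamma_ibp k (fun y => stF a ((Real.log y + s - m) / σ))
    (fun y => stF' a ((Real.log y + s - m) / σ) / σ) (Real.exp (a * σ + m - s)) (Real.exp_pos _)
    (3 + (3 * (1 + |s - m|) / σ + 1) / σ) (by positivity)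
    (hfm.comp (by fun_prop)) ((hfm'.comp (by fun_prop)).div_const σ)
    (fun y hy => by
      refine (stF_cont a).continuousAt.comp ?_
      exact (((Real.continuousAt_log hy.ne').add_const s).sub continuousAt_const).div_const σ)
    (fun y hy hyb => by
      have hne : (Real.log y + s - m) / σ ≠ a := by
        intro h
        apply hyb
        rw [div_eq_iff hσ.ne'] at h
        rw [← Real.exp_log hy]
        congr 1
        linarith
      have h1 := (((Real.hasDerivAt_log hy.ne').add_const s).sub_const m).div_const σ
      refine ((stF_hasDerivAt a _ hne).comp y h1).congr_deriv ?_
      field_simp)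
    (fun y hy => by
      refine (stF_abs_le a _).trans ?_
      have h1 : 0 ≤ (3 * (1 + |s - m|) / σ + 1) / σ := by positivity
      nlinarith [abs_nonneg (Real.log y), mul_nonneg h1 (abs_nonneg (Real.log y))])
    (fun y hy => by
      rw [abs_div, abs_of_pos hσ]
      have h1 := stF'_abs_le a ((Real.log y + s - m) / σ)
      rw [abs_div, abs_of_pos hσ] at h1
      have h2 : |Real.log y + s - m| ≤ |Real.log y| + |s - m| := by
        rw [add_sub_assoc]; exact abs_add_le _ _
      have hl := abs_nonneg (Real.log y)
      have hsm := abs_nonneg (s - m)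
      calc |stF' a ((Real.log y + s - m) / σ)| / σ
          ≤ (3 * ((|Real.log y| + |s - m|) / σ) + 1) / σ := by
            refine div_le_div_of_nonneg_right (h1.trans ?_) hσ.le
            gcongr
        _ ≤ ((3 * (1 + |s - m|) / σ + 1) * (1 + |Real.log y|)) / σ := by
            refine div_le_div_of_nonneg_right ?_ hσ.le
            have : (3 * (1 + |s - m|) / σ + 1) * (1 + |Real.log y|)
              = 3 * ((|Real.log y| + |s - m|) / σ) + 1 + (3 / σ + 3 * |s - m| * |Real.log y| / σ
                + |Real.log y|) := by field_simp; ring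
            rw [this]
            have : 0 ≤ 3 / σ + 3 * |s - m| * |Real.log y| / σ + |Real.log y| := by positivity
            linarith
        _ = ((3 * (1 + |s - m|) / σ + 1) / σ) * (1 + |Real.log y|) := by ring
        _ ≤ _ := by
            gcongr
            linarith)
  rw [integral_const_mul, ← h, integral_div]
  field_simp

lemma main_big (k : ℕ) (x : ℝ) :
    |((Measure.pi fun _ : Fin (k + 2 + 1) => gammaDist (k + 2 + 1))
        {y | ∑ i, Real.log (y i) ≤ x}).toReal
        - ((gaussianReal (((k + 2 + 1 : ℕ) : ℝ) * ∫ z, Real.log z ∂(gammaDist (k + 2 + 1)))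
            (Real.toNNReal (((k + 2 + 1 : ℕ) : ℝ) *
              ∫ z, (Real.log z - ∫ w, Real.log w ∂(gammaDist (k + 2 + 1))) ^ 2
                ∂(gammaDist (k + 2 + 1)))))
            (Set.Iic x)).toReal|
      ≤ 13 / Real.sqrt ((k + 2 + 1 : ℕ) : ℝ) := by
  have hN : ((k + 2 + 1 : ℕ) : ℝ) = (k:ℝ) + 3 := by push_cast; ring
  rw [hN]
  set P := (Measure.pi fun _ : Fin (k + 2 + 1) => gammaDist (k + 2 + 1)) with hP
  set μ := ∫ z, Real.log z ∂(gammaDist (k + 2 + 1)) with hμ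
  set V := ∫ z, (Real.log z - μ) ^ 2 ∂(gammaDist (k + 2 + 1)) with hV
  set N : ℝ := (k:ℝ) + 3 with hNdef
  have hN0 : 0 < N := by positivity
  obtain ⟨hv1, hv2⟩ := gd_var_bounds k V hV
  rw [← hNdef] at hv1 hv2
  have hNV : 0 < N * V := by linarith
  have hV0 : 0 < V := by
    by_contra h
    nlinarith
  set σ := Real.sqrt (N * V) with hσdef
  have hσ : 0 < σ := Real.sqrt_pos.2 hNV
  have hσ2 : σ ^ 2 = N * V := Real.sq_sqrt hNV.le
  set m := N * μ with hm
  set a := (x - m) / σ with ha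
  have hg : ((gaussianReal m (Real.toNNReal (N * V))) (Set.Iic x)).toReal = gG a := by
    rw [← hσ2]; exact gauss_std m σ x hσ
  rw [hg]
  set W : (Fin (k + 2 + 1) → ℝ) → ℝ := fun y => (∑ j, Real.log (y j) - m) / σ with hW
  have hWm : Measurable W := by simp only [hW]; fun_prop
  -- g
  set g : ℝ → ℝ := fun y => V * (y - (k + 3)) - (Real.log y - μ) with hgdef
  have hgm : Measurable g := by simp only [hgdef]; fun_prop
  obtain ⟨q1, q2⟩ := gd_quad k V μ
  have gI : Integrable g (gammaDist (k + 2 + 1)) :=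
    ((gd_sub k).1.const_mul V).sub ((gd_log_ibp k).1.sub (integrable_const μ))
  have il : Integrable (fun y => Real.log y - μ) (gammaDist (k + 2 + 1)) :=
    (gd_log_ibp k).1.sub (integrable_const μ)
  have g0 : ∫ y, g y ∂(gammaDist (k + 2 + 1)) = 0 := by
    simp only [hgdef]
    rw [integral_sub ((gd_sub k).1.const_mul V) il,
      integral_const_mul, (gd_sub k).2, integral_sub (gd_log_ibp k).1 (integrable_const μ), ← hμ]
    simp
  have gL : MemLp g 2 (gammaDist (k + 2 + 1)) :=
    (memLp_two_iff_integrable_sq hgm.aestronglyMeasurable).2 q1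
  have gV : Var[g; gammaDist (k + 2 + 1)] = V ^ 2 * N - V := by
    rw [variance_eq_sub gL, g0]
    have : ∫ y, (g ^ 2) y ∂(gammaDist (k + 2 + 1)) = V ^ 2 * N - 2 * V + V := by
      simpa only [Pi.pow_apply] using q2
    rw [this]; ring
  set U : (Fin (k + 2 + 1) → ℝ) → ℝ := ∑ i, fun y : Fin (k + 2 + 1) → ℝ => g (y i) with hU
  have hUapp : ∀ y, U y = ∑ i, g (y i) := fun y => by simp [hU]
  have gcL : ∀ i, MemLp (fun y : Fin (k + 2 + 1) → ℝ => g (y i)) 2 P := fun i =>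
    gL.comp_measurePreserving (measurePreserving_eval (fun _ : Fin (k + 2 + 1) =>
      gammaDist (k + 2 + 1)) i)
  have UL : MemLp U 2 P := memLp_finsetSum' _ fun i _ => gcL i
  have UI : Integrable U P := UL.integrable (by norm_num)
  have UV : Var[U; P] = N * (V ^ 2 * N - V) := by
    rw [hU, variance_sum_pi (fun _ => gL), gV]
    simp [hNdef]
    ring
  have U0 : ∫ y, U y ∂P = 0 := by
    simp only [hUapp]
    rw [integral_finsetSum _ fun i _ => (gcL i).integrable (by norm_num)]
    refine Finset.sum_eq_zero fun i _ => ?_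
    rw [hP, integral_comp_eval (μ := fun _ : Fin (k + 2 + 1) => gammaDist (k + 2 + 1))
      hgm.aestronglyMeasurable]
    exact g0
  have U2 : ∫ y, |U y| ∂P ≤ Real.sqrt (17 * V) := by
    apply Real.le_sqrt_of_sq_le
    have h1 := variance_nonneg (fun y => |U y|) P
    have h2 : MemLp (fun y => |U y|) 2 P := UL.abs
    rw [variance_eq_sub h2] at h1
    rw [variance_eq_sub UL, U0] at UV
    simp only [Pi.pow_apply, sq_abs] at h1 UV
    have : N * (V ^ 2 * N - V) ≤ 17 * V := by
      have h3 : N * (V * N - 1) ≤ 17 := by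
        have := mul_le_mul_of_nonneg_left hv2 hN0.le
        have e : N * (1 + 17 / N) = N + 17 := by field_simp
        rw [e] at this
        linarith
      nlinarith
    linarith
  -- Stein identity
  have hst := prod_ibp k a m σ hσ
  have hfm := (stF_cont a).measurable
  have I1 : Integrable (fun y => stF' a (W y)) P := (hst 0).1
  have hsum : N * ∫ y, stF' a (W y) ∂P = σ * ∫ y, ∑ i, stF a (W y) * (y i - N) ∂P := by
    rw [integral_finsetSum _ fun i _ => (hst i).2.1, Finset.mul_sum]
    rw [← Finset.sum_congr rfl fun i _ => (hst i).2.2]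
    simp only [Finset.sum_const, Finset.card_univ, Fintype.card_fin, nsmul_eq_mul, hN]
    rfl
  have IW : Integrable W P := by
    have iL : Integrable (fun y : Fin (k + 2 + 1) → ℝ => ∑ j, Real.log (y j)) P :=
      integrable_finsetSum _ fun j _ =>
        integrable_comp_eval (μ := fun _ : Fin (k + 2 + 1) => gammaDist (k + 2 + 1)) (gd_log_ibp k).1
    exact (iL.sub (integrable_const m)).div_const σ
  have I2 : Integrable (fun y => stF a (W y) * W y) P :=
    IW.bdd_mul (c := 3) (hfm.comp hWm).aestronglyMeasurable
      (Filter.Eventually.of_forall fun y => stF_abs_le a _)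
  have hset : MeasurableSet {y : Fin (k + 2 + 1) → ℝ | ∑ i, Real.log (y i) ≤ x} :=
    measurableSet_le (by fun_prop) measurable_const
  have hdiff : (P {y | ∑ i, Real.log (y i) ≤ x}).toReal - gG a =
      ∫ y, stF' a (W y) ∂P - ∫ y, stF a (W y) * W y ∂P := by
    rw [← integral_sub I1 I2]
    have : (fun y => stF' a (W y) - stF a (W y) * W y) = fun y =>
        ({y : Fin (k + 2 + 1) → ℝ | ∑ i, Real.log (y i) ≤ x}.indicator (fun _ => (1:ℝ)) y) - gG a := by
      funext y
      have hiff : W y ≤ a ↔ ∑ i, Real.log (y i) ≤ x := by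
        simp only [hW, ha]
        rw [div_le_div_iff_of_pos_right hσ]
        constructor <;> intro h <;> linarith
      simp only [stF', Set.indicator, Set.mem_ofPred_eq, hiff]
      ring
    rw [this, integral_sub ((integrable_const (1:ℝ)).indicator hset) (integrable_const _),
      integral_indicator_const _ hset]
    simp [measureReal_def]
  have hfinal : (P {y | ∑ i, Real.log (y i) ≤ x}).toReal - gG a =
      (∫ y, stF a (W y) * U y ∂P) / σ := by
    have I3 : Integrable (fun y => ∑ i, stF a (W y) * (y i - N)) P :=
      integrable_finsetSum _ fun i _ => (hst i).2.1
    have e1 : ∫ y, stF' a (W y) ∂P = (σ / N) * ∫ y, ∑ i, stF a (W y) * (y i - N) ∂P := by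
      field_simp
      linarith
    rw [hdiff, e1, ← integral_const_mul, ← integral_sub (I3.const_mul _) I2, ← integral_div]
    congr 1
    funext y
    have hUy : U y = V * ∑ i, (y i - N) - σ * W y := by
      rw [hUapp]
      simp only [hgdef, hW]
      rw [Finset.sum_sub_distrib, ← Finset.mul_sum, Finset.sum_sub_distrib, mul_div_cancel₀ _ hσ.ne']
      simp [hm, hNdef]
      left; ring
    rw [hUy, ← Finset.mul_sum]
    have e2 : σ / N = V / σ := by
      rw [div_eq_div_iff hN0.ne' hσ.ne']; nlinarith
    rw [e2]
    field_simp
  rw [hfinal, abs_div, abs_of_pos hσ]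
  have hb : |∫ y, stF a (W y) * U y ∂P| ≤ 3 * Real.sqrt (17 * V) := by
    refine (abs_integral_le_integral_abs).trans ?_
    calc ∫ y, |stF a (W y) * U y| ∂P ≤ ∫ y, 3 * |U y| ∂P := by
          refine integral_mono_of_nonneg (Filter.Eventually.of_forall fun y => abs_nonneg _)
            (UI.abs.const_mul 3) (Filter.Eventually.of_forall fun y => ?_)
          simp only [abs_mul]
          exact mul_le_mul_of_nonneg_right (stF_abs_le a _) (abs_nonneg _)
      _ ≤ _ := by rw [integral_const_mul]; linarith
  rw [div_le_div_iff₀ hσ (Real.sqrt_pos.2 hN0)]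
  have h17 : 3 * Real.sqrt 17 ≤ 13 := by
    have : Real.sqrt 17 ≤ 13 / 3 := by
      rw [Real.sqrt_le_left (by norm_num)]; norm_num
    linarith
  calc |∫ y, stF a (W y) * U y ∂P| * Real.sqrt N ≤ (3 * Real.sqrt (17 * V)) * Real.sqrt N := by gcongr
    _ = (3 * Real.sqrt 17) * σ := by
      rw [hσdef, Real.sqrt_mul (by norm_num), Real.sqrt_mul hN0.le]; ring
    _ ≤ 13 * σ := by gcongr

/-- Berry–Esseen for `L = ln Y₁ + ⋯ + ln Yₙ` with `Y₁,…,Yₙ` iid `Gamma(n,1)`: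
the CDF of `L` is within `C/√n` of the CDF of a real Gaussian with mean `n·E[ln Y₁]`
and variance `n·Var[ln Y₁]`. -/
theorem log_R_close_to_gaussian :
    ∃ C : ℝ, ∀ n : ℕ, 1 ≤ n → ∀ x : ℝ,
      |((Measure.pi fun _ : Fin n => gammaDist n) {y | ∑ i, Real.log (y i) ≤ x}).toReal
        - ((gaussianReal ((n : ℝ) * ∫ z, Real.log z ∂(gammaDist n))
            (Real.toNNReal ((n : ℝ) *
              ∫ z, (Real.log z - ∫ w, Real.log w ∂(gammaDist n)) ^ 2 ∂(gammaDist n))))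
            (Set.Iic x)).toReal|
      ≤ C / Real.sqrt n := by
  refine ⟨13, fun n hn x => ?_⟩
  rcases Nat.lt_or_ge n 3 with h | h
  · obtain ⟨j, rfl⟩ : ∃ j, n = j + 1 := ⟨n - 1, by omega⟩
    have h1 : ∀ p q : ℝ, 0 ≤ p → p ≤ 1 → 0 ≤ q → q ≤ 1 → |p - q| ≤ 1 := fun p q a b c d => by
      rw [abs_le]; constructor <;> linarith
    refine (h1 _ _ measureReal_nonneg measureReal_le_one measureReal_nonneg
      measureReal_le_one).trans ?_
    have hj : (0:ℝ) < ((j + 1 : ℕ) : ℝ) := by positivity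
    rw [le_div_iff₀ (Real.sqrt_pos.2 hj), one_mul, Real.sqrt_le_left (by norm_num)]
    have : ((j + 1 : ℕ) : ℝ) ≤ 3 := by exact_mod_cast h.le
    linarith
  · obtain ⟨k, rfl⟩ : ∃ k, n = k + 2 + 1 := ⟨n - 3, by omega⟩
    exact main_big k x
end

section
/- Let D = (p_x)_{x∈[N]} be a probability distribution on a finite set [N] = {1,…,N} and let ε ∈ (0,1]. Then there exists a probability distribution D′ = (q_x)_{x∈[N]} on [N] such that (1/2)·∑_{x∈[N]} |p_x − q_x| ≤ ε and H_min(D′) ≥ H₂(D) − log₂(1/ε), where H_min(D′) := min{log₂(1/q_x) : x ∈ [N], q_x > 0} is the min-entropy and H₂(D) := −log₂ ∑_{x∈[N]} p_x² is the 2-entropy. -/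
/-- Renner–Wolf smoothing lemma: for any distribution `D = (p_x)` on `[N]` and
`ε ∈ (0,1]`, there is a distribution `D′ = (q_x)` on `[N]` with
`‖D − D′‖ ≤ ε` and `H_min(D′) ≥ H₂(D) − log₂(1/ε)`, where the min-entropy bound
is expressed as: every `x` in the support of `D′` has `log₂(1/q_x) ≥ H₂(D) − log₂(1/ε)`. -/
theorem smoothed_min_entropy {N : ℕ}
    (p : Fin N → ℝ) (hp0 : ∀ x, 0 ≤ p x) (hp1 : ∑ x, p x = 1)
    (ε : ℝ) (hε0 : 0 < ε) (hε1 : ε ≤ 1) :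
    ∃ q : Fin N → ℝ, (∀ x, 0 ≤ q x) ∧ (∑ x, q x = 1) ∧
      (1/2) * ∑ x, |p x - q x| ≤ ε ∧
      ∀ x, 0 < q x →
        -Real.logb 2 (∑ y, (p y) ^ 2) - Real.logb 2 (1/ε) ≤ Real.logb 2 (1 / q x) := by
  have hcs : (1:ℝ) ≤ N * ∑ y, (p y) ^ 2 := by
    have h := sq_sum_le_card_mul_sum_sq (s := Finset.univ) (f := p)
    rw [hp1] at h
    simpa using h
  obtain ⟨S, hS⟩ : ∃ S, S = ∑ y, (p y) ^ 2 := ⟨_, rfl⟩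
  rw [← hS] at hcs ⊢
  have hS0 : 0 < S := by
    have h0 : 0 ≤ S := hS ▸ Finset.sum_nonneg fun y _ => sq_nonneg (p y)
    rcases h0.lt_or_eq with h | h
    · exact h
    · rw [← h] at hcs; norm_num at hcs
  obtain ⟨c, hc⟩ : ∃ c, c = S / ε := ⟨_, rfl⟩
  have hc0 : 0 < c := hc ▸ div_pos hS0 hε0
  have hcS : ε * c = S := by rw [hc]; field_simp
  have hNc : (1:ℝ) ≤ N * c := by
    have : S ≤ c := by nlinarith
    exact hcs.trans (mul_le_mul_of_nonneg_left this (Nat.cast_nonneg N))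
  obtain ⟨m, hm⟩ : ∃ m : Fin N → ℝ, m = fun x => min (p x) c := ⟨_, rfl⟩
  have hmp : ∀ x, m x ≤ p x := fun x => by rw [hm]; exact min_le_left _ _
  have hmc : ∀ x, m x ≤ c := fun x => by rw [hm]; exact min_le_right _ _
  have hm0 : ∀ x, 0 ≤ m x := fun x => by rw [hm]; exact le_min (hp0 x) hc0.le
  obtain ⟨E, hE⟩ : ∃ E, E = ∑ x, (p x - m x) := ⟨_, rfl⟩
  obtain ⟨R, hR⟩ : ∃ R, R = ∑ x, (c - m x) := ⟨_, rfl⟩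
  have hE0 : 0 ≤ E := hE ▸ Finset.sum_nonneg fun x _ => sub_nonneg.2 (hmp x)
  have hEε : E ≤ ε := by
    have : E * c ≤ ε * c := by
      rw [hcS, hE, hS, Finset.sum_mul]
      refine Finset.sum_le_sum fun x _ => ?_
      rw [hm]
      rcases le_total (p x) c with h | h
      · simp only [min_eq_left h, sub_self, zero_mul]; positivity
      · simp only [min_eq_right h]; nlinarith [hp0 x]
    exact le_of_mul_le_mul_right this hc0
  have hER : E ≤ R := by
    have h1 : E = 1 - ∑ x, m x := by rw [hE, Finset.sum_sub_distrib, hp1]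
    have h2 : R = N * c - ∑ x, m x := by rw [hR, Finset.sum_sub_distrib]; simp
    linarith
  have htR : E / R * R = E := by
    by_cases h : R = 0
    · have : E = 0 := by linarith
      simp [this]
    · field_simp
  have hR0 : 0 ≤ R := hE0.trans hER
  have ht0 : 0 ≤ E / R := div_nonneg hE0 hR0
  have ht1 : E / R ≤ 1 := div_le_one_of_le₀ hER hR0
  obtain ⟨t, ht⟩ : ∃ t, t = E / R := ⟨_, rfl⟩
  rw [← ht] at htR ht0 ht1
  have hsum : ∑ x, t * (c - m x) = E := by rw [← Finset.mul_sum, ← hR, htR]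
  refine ⟨fun x => m x + t * (c - m x), fun x => ?_, ?_, ?_, fun x hx => ?_⟩
  · exact add_nonneg (hm0 x) (mul_nonneg ht0 (sub_nonneg.2 (hmc x)))
  · rw [Finset.sum_add_distrib, hsum, hE, Finset.sum_sub_distrib, hp1]; ring
  · have : ∑ x, |p x - (m x + t * (c - m x))| ≤ ∑ x, ((p x - m x) + t * (c - m x)) := by
      refine Finset.sum_le_sum fun x _ => ?_
      have h1 := hmp x
      have h2 := mul_nonneg ht0 (sub_nonneg.2 (hmc x))
      rw [abs_le]; constructor <;> linarith
    rw [Finset.sum_add_distrib, hsum, ← hE] at this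
    linarith
  · have hq : m x + t * (c - m x) ≤ c := by nlinarith [hmc x]
    have h1 : Real.logb 2 (m x + t * (c - m x)) ≤ Real.logb 2 c :=
      Real.logb_le_logb_of_le (by norm_num) hx hq
    have h2 : Real.logb 2 c = Real.logb 2 S - Real.logb 2 ε := by
      rw [hc, Real.logb_div hS0.ne' hε0.ne']
    simp only [one_div, Real.logb_inv]
    linarith
end
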